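/- If M_s and N_{s'} are bisimilar pointed epistemic models and φ ∈ L_BAPAL holds at M_s, then the updated pointed models M^φ_s and N^φ_{s'} are bisimilar. -/

import Mathlib

/-- Boolean (propositional) formulas over atoms `P`. -/
inductive PLForm (P : Type) : Type
  | atom : P → PLForm P
  | neg : PLForm P → PLForm P
  | and : PLForm P → PLForm P → PLForm P

/-- The language L_BAPAL over agents `A` and atoms `P`. -/
inductive Form (A P : Type) : Type
  | atom : P → Form A P
  | neg : Form A P → Form A P
  | and : Form A P → Form A P → Form A P
  | know : A → Form A P → Form A P
  | ann : Form A P → Form A P → Form A P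
  | box : Form A P → Form A P

def PLForm.toForm {A P : Type} : PLForm P → Form A P
  | .atom p => .atom p
  | .neg φ => .neg φ.toForm
  | .and φ ψ => .and φ.toForm ψ.toForm

structure Model (A P : Type) where
  S : Type
  rel : A → S → S → Prop
  val : P → S → Prop

/-- An epistemic model: each accessibility relation is an equivalence relation. -/
def Model.IsEpistemic {A P : Type} (M : Model A P) : Prop :=
  ∀ a : A, Equivalence (M.rel a)

/-- Restriction of a model to a subset of its states. -/
def Model.restrict {A P : Type} (M : Model A P) (X : Set M.S) : Model A P where
  S := X
  rel a s t := M.rel a s.val t.val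
  val p s := M.val p s.val

/-- Satisfaction of boolean formulas. -/
def SatPL {A P : Type} (M : Model A P) (s : M.S) : PLForm P → Prop
  | .atom p => M.val p s
  | .neg φ => ¬ SatPL M s φ
  | .and φ ψ => SatPL M s φ ∧ SatPL M s ψ

/-- BAPAL satisfaction. -/
def Sat {A P : Type} : (M : Model A P) → M.S → Form A P → Prop
  | M, s, .atom p => M.val p s
  | M, s, .neg φ => ¬ Sat M s φ
  | M, s, .and φ ψ => Sat M s φ ∧ Sat M s ψ
  | M, s, .know a φ => ∀ t : M.S, M.rel a s t → Sat M t φ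
  | M, s, .ann φ ψ => ∀ h : Sat M s φ, Sat (M.restrict {t | Sat M t φ}) ⟨s, h⟩ ψ
  | M, s, .box ψ => ∀ (φ₀ : PLForm P) (h : SatPL M s φ₀),
      Sat (M.restrict {t | SatPL M t φ₀}) ⟨s, h⟩ ψ

def Valid {A P : Type} (φ : Form A P) : Prop :=
  ∀ M : Model A P, M.IsEpistemic → ∀ s : M.S, Sat M s φ

def Form.imp {A P : Type} (φ ψ : Form A P) : Form A P := .neg (.and φ (.neg ψ))
def Form.iff {A P : Type} (φ ψ : Form A P) : Form A P := .and (φ.imp ψ) (ψ.imp φ)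
def Form.dia {A P : Type} (φ : Form A P) : Form A P := .neg (.box (.neg φ))
def Form.khat {A P : Type} (a : A) (φ : Form A P) : Form A P := .neg (.know a (.neg φ))
def Form.diaAnn {A P : Type} (φ ψ : Form A P) : Form A P := .neg (.ann φ (.neg ψ))

def Form.occurs {A P : Type} (q : P) : Form A P → Prop
  | .atom p => p = q
  | .neg φ => φ.occurs q
  | .and φ ψ => φ.occurs q ∨ ψ.occurs q
  | .know _ φ => φ.occurs q
  | .ann φ ψ => φ.occurs q ∨ ψ.occurs q
  | .box φ => φ.occurs q

def Form.mapAtoms {A P Q : Type} (f : P → Q) : Form A P → Form A Q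
  | .atom p => .atom (f p)
  | .neg φ => .neg (φ.mapAtoms f)
  | .and φ ψ => .and (φ.mapAtoms f) (ψ.mapAtoms f)
  | .know a φ => .know a (φ.mapAtoms f)
  | .ann φ ψ => .ann (φ.mapAtoms f) (ψ.mapAtoms f)
  | .box φ => .box (φ.mapAtoms f)
/-- `R` is a bisimulation between models `M` and `N`. -/
def IsBisim {A P : Type} (M N : Model A P) (R : M.S → N.S → Prop) : Prop :=
  (∃ s t, R s t) ∧
  ∀ s t, R s t →
    (∀ p : P, M.val p s ↔ N.val p t) ∧
    (∀ (a : A) (s' : M.S), M.rel a s s' → ∃ t' : N.S, N.rel a t t' ∧ R s' t') ∧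
    (∀ (a : A) (t' : N.S), N.rel a t t' → ∃ s' : M.S, M.rel a s s' ∧ R s' t')

/-- `M_s` and `N_t` are bisimilar. -/
def Bisimilar {A P : Type} (M N : Model A P) (s : M.S) (t : N.S) : Prop :=
  ∃ R, IsBisim M N R ∧ R s t

/-- Restricting both models to sets of states on which related states agree turns a bisimulation
into a bisimulation between the restrictions. -/
theorem IsBisim.restrict {A P : Type} {M N : Model A P} {R : M.S → N.S → Prop}
    (hR : IsBisim M N R) {X : Set M.S} {Y : Set N.S} (hXY : ∀ u v, R u v → (u ∈ X ↔ v ∈ Y))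
    {s : M.S} {t : N.S} (hst : R s t) (hs : s ∈ X) :
    IsBisim (M.restrict X) (N.restrict Y) (fun u v => R u.val v.val) := by
  refine ⟨⟨⟨s, hs⟩, ⟨t, (hXY s t hst).1 hs⟩, hst⟩, ?_⟩
  rintro ⟨u, hu⟩ ⟨v, hv⟩ huv
  obtain ⟨hatom, hforth, hback⟩ := hR.2 u v huv
  refine ⟨hatom, ?_, ?_⟩
  · rintro a ⟨u', hu'⟩ hrel
    obtain ⟨v', hv', hR'⟩ := hforth a u' hrel
    exact ⟨⟨v', (hXY u' v' hR').1 hu'⟩, hv', hR'⟩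
  · rintro a ⟨v', hv'⟩ hrel
    obtain ⟨u', hu', hR'⟩ := hback a v' hrel
    exact ⟨⟨u', (hXY u' v' hR').2 hv'⟩, hu', hR'⟩

/-- Boolean formulas are invariant under bisimulation. -/
theorem IsBisim.satPL_iff {A P : Type} {M N : Model A P} {R : M.S → N.S → Prop}
    (hR : IsBisim M N R) (φ : PLForm P) {s : M.S} {t : N.S} (hst : R s t) :
    SatPL M s φ ↔ SatPL N t φ := by
  induction φ with
  | atom p => exact (hR.2 s t hst).1 p
  | neg φ ih => exact not_congr ih
  | and φ ψ ihφ ihψ => exact and_congr ihφ ihψ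

/-- BAPAL formulas are invariant under bisimulation. -/
theorem IsBisim.sat_iff {A P : Type} {M N : Model A P} {R : M.S → N.S → Prop}
    (hR : IsBisim M N R) (φ : Form A P) {s : M.S} {t : N.S} (hst : R s t) :
    Sat M s φ ↔ Sat N t φ := by
  induction φ generalizing M N with
  | atom p => simpa only [Sat] using (hR.2 s t hst).1 p
  | neg φ ih => simpa only [Sat] using not_congr (ih hR hst)
  | and φ ψ ihφ ihψ => simpa only [Sat] using and_congr (ihφ hR hst) (ihψ hR hst)
  | know a φ ih =>
    obtain ⟨-, hforth, hback⟩ := hR.2 s t hst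
    simp only [Sat]
    constructor
    · intro h t' ht'
      obtain ⟨s', hs', hR'⟩ := hback a t' ht'
      exact (ih hR hR').1 (h s' hs')
    · intro h s' hs'
      obtain ⟨t', ht', hR'⟩ := hforth a s' hs'
      exact (ih hR hR').2 (h t' ht')
  | ann φ ψ ihφ ihψ =>
    simp only [Sat]
    have key (hs : Sat M s φ) (ht : Sat N t φ) :
        Sat (M.restrict {u | Sat M u φ}) ⟨s, hs⟩ ψ ↔ Sat (N.restrict {v | Sat N v φ}) ⟨t, ht⟩ ψ :=
      ihψ (hR.restrict (fun _ _ huv => ihφ hR huv) hst hs) hst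
    have hφ := ihφ hR hst
    exact ⟨fun h ht => (key (hφ.2 ht) ht).1 (h _), fun h hs => (key hs (hφ.1 hs)).2 (h _)⟩
  | box ψ ih =>
    simp only [Sat]
    have key (φ₀ : PLForm P) (hs : SatPL M s φ₀) (ht : SatPL N t φ₀) :
        Sat (M.restrict {u | SatPL M u φ₀}) ⟨s, hs⟩ ψ ↔
          Sat (N.restrict {v | SatPL N v φ₀}) ⟨t, ht⟩ ψ :=
      ih (hR.restrict (fun _ _ huv => hR.satPL_iff φ₀ huv) hst hs) hst
    have hφ (φ₀ : PLForm P) := hR.satPL_iff φ₀ hst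
    exact ⟨fun h φ₀ ht => (key φ₀ ((hφ φ₀).2 ht) ht).1 (h φ₀ _),
      fun h φ₀ hs => (key φ₀ hs ((hφ φ₀).1 hs)).2 (h φ₀ _)⟩

/-- if `M_s` and `N_t` are bisimilar and `φ` holds at `M_s`, then the
updated pointed models `M^φ_s` and `N^φ_t` are bisimilar. -/
theorem bisimilar_update {A : Type} [Countable A]
    (M N : Model A ℕ) (hM : M.IsEpistemic) (hN : N.IsEpistemic)
    (s : M.S) (t : N.S) (h : Bisimilar M N s t)
    (φ : Form A ℕ) (hs : Sat M s φ) :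
    ∃ ht : Sat N t φ,
      Bisimilar (M.restrict {u | Sat M u φ}) (N.restrict {u | Sat N u φ}) ⟨s, hs⟩ ⟨t, ht⟩ := by
  obtain ⟨R, hR, hst⟩ := h
  exact ⟨(hR.sat_iff φ hst).1 hs, fun u v => R u.val v.val,
    hR.restrict (fun _ _ huv => hR.sat_iff φ huv) hst hs, hst⟩
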